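/- Let N, M ≥ 1 be natural numbers and Δf, T > 0 reals. For centered indices n_k = k − (N−1)/2 (k = 0,…,N−1) and m_l = l − (M−1)/2 (l = 0,…,M−1), define the steering entries a_{k,l}(τ, f) = exp(i(−2π n_k Δf τ + 2π m_l T f)) ∈ ℂ. Then for all τ, f ∈ ℝ: (i) Σ_{k,l} |∂a_{k,l}/∂τ|² = 4π² Δf² · M N (N²−1)/12; (ii) Σ_{k,l} |∂a_{k,l}/∂f|² = 4π² T² · N M (M²−1)/12; (iii) Σ_{k,l} conj(∂a_{k,l}/∂τ) · (∂a_{k,l}/∂f) = 0. -/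

import Mathlib

open Finset Real Complex

/-- The delay–Doppler steering entry over centered indices. -/
noncomputable def steeringEntry (N M : ℕ) (Δf T : ℝ) (k l : ℕ) (τ f : ℝ) : ℂ :=
  Complex.exp (Complex.I *
    ((-(2 * π * ((k : ℝ) - ((N : ℝ) - 1) / 2) * Δf * τ) : ℝ) +
     ((2 * π * ((l : ℝ) - ((M : ℝ) - 1) / 2) * T * f) : ℝ)))

lemma aux_sum_c (N : ℕ) (c : ℝ) : ∑ k ∈ Finset.range N, ((k : ℝ) - c)
    = (N : ℝ) * ((N : ℝ) - 1) / 2 - N * c := by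
  induction N with
  | zero => simp
  | succ n ih => rw [Finset.sum_range_succ, ih]; push_cast; ring

lemma aux_sum_sq (N : ℕ) (c : ℝ) : ∑ k ∈ Finset.range N, ((k : ℝ) - c) ^ 2
    = (N : ℝ) * ((N : ℝ) - 1) * (2 * N - 1) / 6 - c * (N * ((N : ℝ) - 1)) + N * c ^ 2 := by
  induction N with
  | zero => simp
  | succ n ih => rw [Finset.sum_range_succ, ih]; push_cast; ring

lemma aux_deriv (A b x : ℝ) : HasDerivAt
    (fun t : ℝ => Complex.exp (Complex.I * (((A * t + b : ℝ)) : ℂ)))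
    (Complex.exp (Complex.I * ((A * x + b : ℝ) : ℂ)) * (Complex.I * (A : ℂ))) x := by
  have h : HasDerivAt (fun t : ℝ => A * t + b) A x := by
    simpa using ((hasDerivAt_id x).const_mul A).add_const b
  exact (h.ofReal_comp.const_mul Complex.I).cexp

lemma aux_dtau (N M : ℕ) (Δf T : ℝ) (k l : ℕ) (τ f : ℝ) :
    deriv (fun τ' : ℝ => steeringEntry N M Δf T k l τ' f) τ = steeringEntry N M Δf T k l τ f *
      (Complex.I * ((-(2 * π * ((k : ℝ) - ((N : ℝ) - 1) / 2) * Δf) : ℝ) : ℂ)) := by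
  have h := (aux_deriv (-(2 * π * ((k : ℝ) - ((N : ℝ) - 1) / 2) * Δf))
    (2 * π * ((l : ℝ) - ((M : ℝ) - 1) / 2) * T * f) τ).deriv
  have e : ∀ t : ℝ, steeringEntry N M Δf T k l t f = Complex.exp (Complex.I *
      ((-(2 * π * ((k : ℝ) - ((N : ℝ) - 1) / 2) * Δf) * t +
        2 * π * ((l : ℝ) - ((M : ℝ) - 1) / 2) * T * f : ℝ) : ℂ)) := by
    intro t
    unfold steeringEntry
    rw [← Complex.ofReal_add]
    congr 3
    ring
  simp only [e]
  exact h

lemma aux_df (N M : ℕ) (Δf T : ℝ) (k l : ℕ) (τ f : ℝ) :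
    deriv (fun f' : ℝ => steeringEntry N M Δf T k l τ f') f = steeringEntry N M Δf T k l τ f *
      (Complex.I * ((2 * π * ((l : ℝ) - ((M : ℝ) - 1) / 2) * T : ℝ) : ℂ)) := by
  have h := (aux_deriv (2 * π * ((l : ℝ) - ((M : ℝ) - 1) / 2) * T)
    (-(2 * π * ((k : ℝ) - ((N : ℝ) - 1) / 2) * Δf * τ)) f).deriv
  have e : ∀ t : ℝ, steeringEntry N M Δf T k l τ t = Complex.exp (Complex.I *
      ((2 * π * ((l : ℝ) - ((M : ℝ) - 1) / 2) * T * t +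
        -(2 * π * ((k : ℝ) - ((N : ℝ) - 1) / 2) * Δf * τ) : ℝ) : ℂ)) := by
    intro t
    unfold steeringEntry
    rw [← Complex.ofReal_add]
    congr 3
    ring
  simp only [e]
  exact h

lemma aux_norm (N M : ℕ) (Δf T : ℝ) (k l : ℕ) (τ f : ℝ) :
    ‖steeringEntry N M Δf T k l τ f‖ = 1 := by
  unfold steeringEntry
  rw [← Complex.ofReal_add, mul_comm]
  exact Complex.norm_exp_ofReal_mul_I _

lemma aux_cross (z : ℂ) (hz : ‖z‖ = 1) (A B : ℝ) :
    (starRingEnd ℂ) (z * (Complex.I * (A : ℂ))) * (z * (Complex.I * (B : ℂ)))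
      = ((A * B : ℝ) : ℂ) := by
  have h : (starRingEnd ℂ) z * z = 1 := by
    rw [Complex.conj_mul', hz]; simp
  simp only [map_mul, Complex.conj_I, Complex.conj_ofReal]
  push_cast
  linear_combination (A * B : ℂ) * h - (A * B * ((starRingEnd ℂ) z * z) : ℂ) * Complex.I_sq

/-- Fisher-information sums for the OFDM delay–Doppler steering vector:
squared norms of the partial derivatives give the diagonal FIM entries,
and the cross inner product vanishes under centered indexing. -/
theorem steering_fim_sums (N M : ℕ) (hN : 1 ≤ N) (hM : 1 ≤ M)
    (Δf T : ℝ) (hΔf : 0 < Δf) (hT : 0 < T) (τ f : ℝ) :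
    (∑ k ∈ Finset.range N, ∑ l ∈ Finset.range M,
        ‖deriv (fun τ' : ℝ => steeringEntry N M Δf T k l τ' f) τ‖ ^ 2
      = 4 * π ^ 2 * Δf ^ 2 * (M : ℝ) * (N : ℝ) * ((N : ℝ) ^ 2 - 1) / 12) ∧
    (∑ k ∈ Finset.range N, ∑ l ∈ Finset.range M,
        ‖deriv (fun f' : ℝ => steeringEntry N M Δf T k l τ f') f‖ ^ 2
      = 4 * π ^ 2 * T ^ 2 * (N : ℝ) * (M : ℝ) * ((M : ℝ) ^ 2 - 1) / 12) ∧
    (∑ k ∈ Finset.range N, ∑ l ∈ Finset.range M,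
        (starRingEnd ℂ) (deriv (fun τ' : ℝ => steeringEntry N M Δf T k l τ' f) τ) *
          deriv (fun f' : ℝ => steeringEntry N M Δf T k l τ f') f
      = 0) := by
  refine ⟨?_, ?_, ?_⟩
  · simp only [aux_dtau, norm_mul, aux_norm, Complex.norm_I, Complex.norm_real, one_mul,
      Real.norm_eq_abs, sq_abs, Finset.sum_const, Finset.card_range, nsmul_eq_mul]
    have h := aux_sum_sq N (((N : ℝ) - 1) / 2)
    calc _ = ∑ k ∈ Finset.range N, (4 * π ^ 2 * Δf ^ 2 * M) *
          ((k : ℝ) - ((N : ℝ) - 1) / 2) ^ 2 := by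
            apply Finset.sum_congr rfl; intros
            ring
      _ = _ := by rw [← Finset.mul_sum, h]; ring
  · simp only [aux_df, norm_mul, aux_norm, Complex.norm_I, Complex.norm_real, one_mul,
      Real.norm_eq_abs, sq_abs, Finset.sum_const, Finset.card_range, nsmul_eq_mul]
    have h := aux_sum_sq M (((M : ℝ) - 1) / 2)
    calc _ = (N : ℝ) * ∑ l ∈ Finset.range M, (4 * π ^ 2 * T ^ 2) *
          ((l : ℝ) - ((M : ℝ) - 1) / 2) ^ 2 := by
            congr 1
            apply Finset.sum_congr rfl; intros
            simp only [mul_pow, sq_abs]; ring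
      _ = _ := by rw [← Finset.mul_sum, h]; ring
  · simp only [aux_dtau, aux_df, aux_cross _ (aux_norm _ _ _ _ _ _ _ _)]
    have h := aux_sum_c M (((M : ℝ) - 1) / 2)
    apply Finset.sum_eq_zero
    intro k _
    rw [← Complex.ofReal_sum, ← Finset.mul_sum, ← Finset.sum_mul, ← Finset.mul_sum, h]
    rw [Complex.ofReal_eq_zero]
    ring
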